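/- For each k ∈ {2, …, M+2}, if D₁ ⊆ N∖M and D₂ ⊆ N∖M are both self-decodable at node π(k), then their union D₁ ∪ D₂ is also self-decodable at node π(k). -/

import Mathlib

open scoped BigOperators

set_option synthInstance.maxHeartbeats 1000000
set_option synthInstance.maxSize 1024
set_option maxHeartbeats 1000000

/-- Shannon entropy (natural log) of a random variable `X` on a finite sample
space `Ω` with probability mass function `μ`. -/
noncomputable def entropy {Ω α : Type*} [Fintype Ω] [Fintype α] [DecidableEq α]
    (μ : Ω → ℝ) (X : Ω → α) : ℝ :=
  ∑ a : α, Real.negMulLog (∑ ω ∈ Finset.univ.filter (fun ω => X ω = a), μ ω)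

/-- Conditional mutual information `I(X;Y|Z)` for random variables on a finite
sample space with pmf `μ`. -/
noncomputable def condMI {Ω α β γ : Type*} [Fintype Ω]
    [Fintype α] [DecidableEq α] [Fintype β] [DecidableEq β] [Fintype γ] [DecidableEq γ]
    (μ : Ω → ℝ) (X : Ω → α) (Y : Ω → β) (Z : Ω → γ) : ℝ :=
  entropy μ (fun ω => (X ω, Z ω)) + entropy μ (fun ω => (Y ω, Z ω))
    - entropy μ (fun ω => (X ω, Y ω, Z ω)) - entropy μ Z

/-- Sample space for the unified D-F/C-F multiple-relay framework: a value of
`(q, x₀, (xᵢ)ᵢ, (yᵢ)ᵢ, y_{n+1}, (ŷᵢ)ᵢ)`. -/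
abbrev DFOmega {n : ℕ} (QA X0A : Type) (XA YA : Fin n → Type) (YdA : Type)
    (YhA : Fin n → Type) : Type :=
  QA × X0A × (∀ i, XA i) × (∀ i, YA i) × YdA × (∀ i, YhA i)

section DF

variable {n Mc : ℕ} {QA X0A YdA : Type} {XA YA YhA : Fin n → Type}

/-- The time-sharing variable `Q`. -/
def rvQ : DFOmega QA X0A XA YA YdA YhA → QA := fun ω => ω.1

/-- The source input `X₀`. -/
def rvX0 : DFOmega QA X0A XA YA YdA YhA → X0A := fun ω => ω.2.1

/-- The tuple of relay inputs `X_S = (Xᵢ)_{i∈S}`. -/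
def rvXS (S : Finset (Fin n)) : DFOmega QA X0A XA YA YdA YhA → (∀ i : S, XA i) :=
  fun ω i => ω.2.2.1 i

/-- The tuple of relay outputs `Y_S = (Yᵢ)_{i∈S}`. -/
def rvYS (S : Finset (Fin n)) : DFOmega QA X0A XA YA YdA YhA → (∀ i : S, YA i) :=
  fun ω i => ω.2.2.2.1 i

/-- The destination output `Y_{n+1}`. -/
def rvYd : DFOmega QA X0A XA YA YdA YhA → YdA := fun ω => ω.2.2.2.2.1

/-- The tuple of compressions `Ŷ_S = (Ŷᵢ)_{i∈S}`. -/
def rvYhS (S : Finset (Fin n)) : DFOmega QA X0A XA YA YdA YhA → (∀ i : S, YhA i) :=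
  fun ω i => ω.2.2.2.2.2 i

/-- The joint pmf
`p(q)·p(x₀|q)·p(x_M|x₀,q)·∏_{i∈N∖M} p(xᵢ|q) · p(y₁,…,y_{n+1}|x₀,…,x_n) ·
∏ p(ŷᵢ|yᵢ,xᵢ,q)`. -/
noncomputable def muDF (ℳ : Finset (Fin n)) (pQ : QA → ℝ) (p0 : QA → X0A → ℝ)
    (pM : QA → X0A → (∀ i : ℳ, XA i) → ℝ) (pC : ∀ i : Fin n, QA → XA i → ℝ)
    (W : X0A → (∀ i, XA i) → ((∀ i, YA i) × YdA) → ℝ)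
    (κ : ∀ i : Fin n, QA → YA i → XA i → YhA i → ℝ) :
    DFOmega QA X0A XA YA YdA YhA → ℝ :=
  fun ω => pQ ω.1 * p0 ω.1 ω.2.1 * pM ω.1 ω.2.1 (fun i => ω.2.2.1 i)
    * (∏ i ∈ ℳᶜ, pC i ω.1 (ω.2.2.1 i))
    * W ω.2.1 ω.2.2.1 (ω.2.2.2.1, ω.2.2.2.2.1)
    * ∏ i, κ i ω.1 (ω.2.2.2.1 i) (ω.2.2.1 i) (ω.2.2.2.2.2 i)

/-- The set of relays upstream of node `π(k)` in the D-F route, i.e. the relays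
`π(2:k-1)` of the paper: with `σ` enumerating the D-F relays in route order and
`k : Fin (Mc+1)` standing for the paper's index `k+2 ∈ {2,…,M+2}`, this is
`{σ j : j < k}`. -/
def upSet (σ : Fin Mc → Fin n) (k : Fin (Mc + 1)) : Finset (Fin n) :=
  (Finset.univ.filter (fun j : Fin Mc => (j : ℕ) < (k : ℕ))).image σ

/-- The set of relays `π(k:M+1)` of the paper, namely the D-F relays downstream
of (and including) node `π(k)`: `{σ j : k ≤ j}`. -/
def downSet (σ : Fin Mc → Fin n) (k : Fin (Mc + 1)) : Finset (Fin n) :=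
  (Finset.univ.filter (fun j : Fin Mc => (k : ℕ) ≤ (j : ℕ))).image σ

/-- The alphabet of the channel output `Y_{π(k)}` observed at node `π(k)`: a relay
output for `k < Mc`, and the destination output for `k = Mc` (paper `k = M+2`). -/
def YkType (σ : Fin Mc → Fin n) (YA : Fin n → Type) (YdA : Type)
    (k : Fin (Mc + 1)) : Type :=
  if h : (k : ℕ) < Mc then YA (σ ⟨(k : ℕ), h⟩) else YdA

instance YkType.instFintype (σ : Fin Mc → Fin n) [∀ i, Fintype (YA i)] [Fintype YdA]
    (k : Fin (Mc + 1)) : Fintype (YkType σ YA YdA k) := by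
  unfold YkType; split <;> infer_instance

instance YkType.instDecidableEq (σ : Fin Mc → Fin n) [∀ i, DecidableEq (YA i)]
    [DecidableEq YdA] (k : Fin (Mc + 1)) : DecidableEq (YkType σ YA YdA k) := by
  unfold YkType; split <;> infer_instance

/-- The channel output `Y_{π(k)}` observed at node `π(k)`. -/
def rvYk (σ : Fin Mc → Fin n) (k : Fin (Mc + 1))
    (ω : DFOmega QA X0A XA YA YdA YhA) : YkType σ YA YdA k :=
  if h : (k : ℕ) < Mc then
    cast (by simp [YkType, h]) (ω.2.2.2.1 (σ ⟨(k : ℕ), h⟩))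
  else
    cast (by simp [YkType, h]) ω.2.2.2.2.1

variable [Fintype QA] [DecidableEq QA] [Fintype X0A] [DecidableEq X0A]
  [Fintype YdA] [DecidableEq YdA]
  [∀ i, Fintype (XA i)] [∀ i, DecidableEq (XA i)]
  [∀ i, Fintype (YA i)] [∀ i, DecidableEq (YA i)]
  [∀ i, Fintype (YhA i)] [∀ i, DecidableEq (YhA i)]

/-- `F_k(T) = min_{S ⊆ T} [ I(X_{π(1:k-1)}, X_S; Ŷ_{T∖S}, Y_{π(k)} | X_{T∖S}, X_{π(k:M+1)}, Q)`
`− I(Y_S; Ŷ_S | X_{π(1:M+1)}, X_T, Y_{π(k)}, Ŷ_{T∖S}, Q) ]`, where `π(1:k-1)`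
consists of the source `0` together with `upSet σ k`, `π(k:M+1) = downSet σ k`,
and `π(1:M+1)` consists of the source together with all D-F relays `ℳ`. -/
noncomputable def Fk (ℳ : Finset (Fin n)) (σ : Fin Mc → Fin n)
    (μ : DFOmega QA X0A XA YA YdA YhA → ℝ) (k : Fin (Mc + 1))
    (T : Finset (Fin n)) : ℝ :=
  T.powerset.inf' (Finset.powerset_nonempty T) fun S =>
    condMI μ (fun ω => ((rvX0 ω, rvXS (upSet σ k) ω), rvXS S ω))
      (fun ω => (rvYhS (T \ S) ω, rvYk σ k ω))
      (fun ω => (rvXS (T \ S) ω, rvXS (downSet σ k) ω, rvQ ω))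
    - condMI μ (rvYS S) (rvYhS S)
      (fun ω => ((rvX0 ω, rvXS ℳ ω), rvXS T ω, rvYk σ k ω, rvYhS (T \ S) ω, rvQ ω))

/-- `D ⊆ N∖M` is self-decodable at node `π(k)` if for every nonempty `S ⊆ D`,
`I(X_S; Ŷ_{D∖S}, Y_{π(k)} | X_{π(1:M+1)}, X_{D∖S}, Q)`
`− I(Y_S; Ŷ_S | X_{π(1:M+1)}, X_D, Y_{π(k)}, Ŷ_{D∖S}, Q) > 0`. -/
def SelfDecodable (ℳ : Finset (Fin n)) (σ : Fin Mc → Fin n)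
    (μ : DFOmega QA X0A XA YA YdA YhA → ℝ) (k : Fin (Mc + 1))
    (D : Finset (Fin n)) : Prop :=
  ∀ S ⊆ D, S.Nonempty →
    0 < condMI μ (rvXS S) (fun ω => (rvYhS (D \ S) ω, rvYk σ k ω))
          (fun ω => ((rvX0 ω, rvXS ℳ ω), rvXS (D \ S) ω, rvQ ω))
      - condMI μ (rvYS S) (rvYhS S)
          (fun ω => ((rvX0 ω, rvXS ℳ ω), rvXS D ω, rvYk σ k ω, rvYhS (D \ S) ω, rvQ ω))

end DF

section Entropy

/-- The mass that `μ` assigns to the event `X = a`. -/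
noncomputable def eventMass {Ω α : Type*} [Fintype Ω] [DecidableEq α]
    (μ : Ω → ℝ) (X : Ω → α) (a : α) : ℝ :=
  ∑ ω ∈ Finset.univ.filter (fun ω => X ω = a), μ ω

theorem eventMass_nonneg {Ω α : Type*} [Fintype Ω] [DecidableEq α] {μ : Ω → ℝ}
    (hμ : ∀ ω, 0 ≤ μ ω) (X : Ω → α) (a : α) : 0 ≤ eventMass μ X a :=
  Finset.sum_nonneg fun ω _ => hμ ω

theorem le_eventMass {Ω α : Type*} [Fintype Ω] [DecidableEq α] {μ : Ω → ℝ}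
    (hμ : ∀ ω, 0 ≤ μ ω) (X : Ω → α) (ω : Ω) : μ ω ≤ eventMass μ X (X ω) :=
  Finset.single_le_sum (f := μ) (fun ω _ => hμ ω) (by simp)

theorem sum_eventMass_prod {Ω α β : Type*} [Fintype Ω] [Fintype α] [DecidableEq α]
    [DecidableEq β] (μ : Ω → ℝ) (X : Ω → α) (Z : Ω → β) (b : β) :
    ∑ a, eventMass μ (fun ω => (X ω, Z ω)) (a, b) = eventMass μ Z b := by
  rw [eventMass, ← Finset.sum_fiberwise _ X]
  refine Finset.sum_congr rfl fun a _ => ?_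
  rw [eventMass, Finset.filter_filter]
  refine Finset.sum_congr (Finset.filter_congr fun ω _ => ?_) fun _ _ => rfl
  rw [Prod.mk.injEq, and_comm]

/-- If the coordinate `X` can be resampled by `u` without affecting `Z` and `R`, and
`μ = R · K(X | s(Z))` for a stochastic kernel `K`, then `K` is the conditional law of `X`
given `Z`. -/
theorem eventMass_prod_of_resample {Ω α β δ : Type*} [Fintype Ω]
    [Fintype α] [DecidableEq α] [DecidableEq β] {μ R : Ω → ℝ} {X : Ω → α} {Z : Ω → β}
    {s : β → δ} {K : δ → α → ℝ} (u : Ω → α → Ω) (hK : ∀ d, ∑ a, K d a = 1)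
    (hXu : ∀ ω a, X (u ω a) = a) (huX : ∀ ω, u ω (X ω) = ω)
    (huu : ∀ ω a b, u (u ω a) b = u ω b) (hZu : ∀ ω a, Z (u ω a) = Z ω)
    (hRu : ∀ ω a, R (u ω a) = R ω) (hμ : ∀ ω, μ ω = R ω * K (s (Z ω)) (X ω)) (a : α) (b : β) :
    eventMass μ (fun ω => (X ω, Z ω)) (a, b) = eventMass μ Z b * K (s b) a := by
  have hfactor : ∀ a, eventMass μ (fun ω => (X ω, Z ω)) (a, b) =
      eventMass R (fun ω => (X ω, Z ω)) (a, b) * K (s b) a := fun a => by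
    rw [eventMass, eventMass, Finset.sum_mul]
    refine Finset.sum_congr rfl fun ω hω => ?_
    obtain ⟨rfl, rfl⟩ := Prod.mk.inj (Finset.mem_filter.1 hω).2
    exact hμ ω
  have hconst : ∀ a', eventMass R (fun ω => (X ω, Z ω)) (a', b) =
      eventMass R (fun ω => (X ω, Z ω)) (a, b) := fun a' => by
    have huX' : ∀ {ω c}, X ω = c → u ω c = ω := by
      rintro ω _ rfl
      exact huX ω
    refine Finset.sum_nbij' (fun ω => u ω a) (fun ω => u ω a') ?_ ?_ ?_ ?_ ?_ <;>
      simp +contextual [hXu, hZu, hRu, huu, huX']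
  rw [← sum_eventMass_prod μ X Z b]
  simp only [hfactor, hconst]
  rw [← Finset.mul_sum, hK, mul_one]

variable {Ω α β γ : Type*} [Fintype Ω] [Fintype α] [DecidableEq α] [Fintype β] [DecidableEq β]
  [Fintype γ] [DecidableEq γ]

theorem sum_eventMass_mul (μ : Ω → ℝ) (X : Ω → α) (g : α → ℝ) :
    ∑ a, eventMass μ X a * g a = ∑ ω, μ ω * g (X ω) := by
  rw [← Finset.sum_fiberwise Finset.univ X]
  refine Finset.sum_congr rfl fun a _ => ?_
  rw [eventMass, Finset.sum_mul]
  refine Finset.sum_congr rfl fun ω hω => ?_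
  rw [(Finset.mem_filter.1 hω).2]

theorem sum_eventMass (μ : Ω → ℝ) (X : Ω → α) : ∑ a, eventMass μ X a = ∑ ω, μ ω := by
  simpa using sum_eventMass_mul μ X fun _ => 1

theorem entropy_eq_sum_log (μ : Ω → ℝ) (X : Ω → α) :
    entropy μ X = ∑ ω, μ ω * -Real.log (eventMass μ X (X ω)) := by
  rw [← sum_eventMass_mul μ X fun a => -Real.log (eventMass μ X a)]
  refine Finset.sum_congr rfl fun a _ => ?_
  rw [Real.negMulLog, eventMass]
  ring

/-- Entropy depends on a random variable only through the partition it induces. -/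
theorem entropy_congr (μ : Ω → ℝ) {X : Ω → α} {Y : Ω → β}
    (h : ∀ ω ω', X ω = X ω' ↔ Y ω = Y ω') : entropy μ X = entropy μ Y := by
  simp only [entropy_eq_sum_log, eventMass, h]

theorem entropy_comp_of_eventMass {Ω' : Type*} [Fintype Ω'] [DecidableEq Ω'] {μ : Ω → ℝ}
    {ν : Ω' → ℝ} {f : Ω → Ω'} (h : ∀ b, eventMass μ f b = ν b) (Z : Ω' → α) :
    entropy μ (fun ω => Z (f ω)) = entropy ν Z := by
  have key : ∀ g : Ω' → ℝ, ∑ ω, μ ω * g (f ω) = ∑ b, ν b * g b := fun g => by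
    rw [← sum_eventMass_mul]
    simp only [h]
  refine Finset.sum_congr rfl fun a _ => congrArg _ ?_
  simpa [Finset.sum_filter] using key fun b => if Z b = a then 1 else 0

/-- Conditional mutual information is nonnegative. -/
theorem condMI_nonneg {μ : Ω → ℝ} (hμ : ∀ ω, 0 ≤ μ ω) (X : Ω → α) (Y : Ω → β) (Z : Ω → γ) :
    0 ≤ condMI μ X Y Z := by
  set pXZ := eventMass μ fun ω => (X ω, Z ω) with hXZ
  set pYZ := eventMass μ fun ω => (Y ω, Z ω) with hYZ
  set p := eventMass μ fun ω => (X ω, Y ω, Z ω) with hp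
  set pZ := eventMass μ Z with hZ
  have hmi : condMI μ X Y Z = ∑ ω, μ ω * (Real.log (p (X ω, Y ω, Z ω)) + Real.log (pZ (Z ω))
      - Real.log (pXZ (X ω, Z ω)) - Real.log (pYZ (Y ω, Z ω))) := by
    simp only [condMI, entropy_eq_sum_log, ← Finset.sum_add_distrib, ← Finset.sum_sub_distrib]
    refine Finset.sum_congr rfl fun ω _ => ?_
    simp only [hXZ, hYZ, hp, hZ]
    ring
  let q : α × β × γ → ℝ := fun t => pXZ (t.1, t.2.2) * pYZ t.2 / pZ t.2.2
  have hq : ∀ t, 0 ≤ q t := fun t =>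
    div_nonneg (mul_nonneg (eventMass_nonneg hμ _ _) (eventMass_nonneg hμ _ _))
      (eventMass_nonneg hμ _ _)
  have hpoint : ∀ ω, μ ω - μ ω * (q (X ω, Y ω, Z ω) / p (X ω, Y ω, Z ω)) ≤
      μ ω * (Real.log (p (X ω, Y ω, Z ω)) + Real.log (pZ (Z ω))
      - Real.log (pXZ (X ω, Z ω)) - Real.log (pYZ (Y ω, Z ω))) := fun ω => by
    rcases (hμ ω).eq_or_lt with h0 | h0
    · simp [← h0]
    have h1 : 0 < p (X ω, Y ω, Z ω) := h0.trans_le (le_eventMass hμ _ ω)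
    have h2 : 0 < pZ (Z ω) := h0.trans_le (le_eventMass hμ _ ω)
    have h3 : 0 < pXZ (X ω, Z ω) := h0.trans_le (le_eventMass hμ (fun ω => (X ω, Z ω)) ω)
    have h4 : 0 < pYZ (Y ω, Z ω) := h0.trans_le (le_eventMass hμ (fun ω => (Y ω, Z ω)) ω)
    have hlog := Real.log_le_sub_one_of_pos
      (show 0 < q (X ω, Y ω, Z ω) / p (X ω, Y ω, Z ω) from
        div_pos (div_pos (mul_pos h3 h4) h2) h1)
    rw [Real.log_div (div_pos (mul_pos h3 h4) h2).ne' h1.ne',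
      Real.log_div (mul_pos h3 h4).ne' h2.ne', Real.log_mul h3.ne' h4.ne'] at hlog
    rw [← mul_one_sub]
    exact mul_le_mul_of_nonneg_left (by linarith) h0.le
  have hsum : ∑ ω, μ ω * (q (X ω, Y ω, Z ω) / p (X ω, Y ω, Z ω)) ≤ ∑ ω, μ ω := by
    rw [← sum_eventMass_mul μ (fun ω => (X ω, Y ω, Z ω)) fun t => q t / p t]
    calc ∑ t, p t * (q t / p t) ≤ ∑ t, q t := Finset.sum_le_sum fun t _ => by
          rcases eq_or_ne (p t) 0 with h | h
          · simpa [h] using hq t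
          · rw [mul_div_cancel₀ _ h]
      _ = ∑ c, pZ c := by
          rw [Fintype.sum_prod_type_right, Fintype.sum_prod_type_right]
          refine Finset.sum_congr rfl fun c _ => ?_
          simp only [q, ← Finset.sum_div, ← Finset.sum_mul, ← Finset.mul_sum]
          rw [hXZ, hYZ, sum_eventMass_prod, sum_eventMass_prod, ← hZ, mul_self_div_self]
      _ = ∑ ω, μ ω := sum_eventMass μ Z
  calc (0 : ℝ) ≤ ∑ ω, (μ ω - μ ω * (q (X ω, Y ω, Z ω) / p (X ω, Y ω, Z ω))) := by
        rw [Finset.sum_sub_distrib]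
        exact sub_nonneg.2 hsum
    _ ≤ _ := Finset.sum_le_sum fun ω _ => hpoint ω
    _ = _ := hmi.symm

/-- Submodularity of entropy: if `U` carries the information of the pair `(X, Y)` and `Z` is
common information of `X` and `Y`, then `H(U) + H(Z) ≤ H(X) + H(Y)`. -/
theorem entropy_add_entropy_le {δ : Type*} [Fintype δ] [DecidableEq δ] {μ : Ω → ℝ}
    (hμ : ∀ ω, 0 ≤ μ ω) {X : Ω → α} {Y : Ω → β} {Z : Ω → γ} {U : Ω → δ}
    (hU : ∀ ω ω', U ω = U ω' ↔ X ω = X ω' ∧ Y ω = Y ω')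
    (hX : ∀ ω ω', X ω = X ω' → Z ω = Z ω') (hY : ∀ ω ω', Y ω = Y ω' → Z ω = Z ω') :
    entropy μ U + entropy μ Z ≤ entropy μ X + entropy μ Y := by
  have h := condMI_nonneg hμ X Y Z
  have e₁ : entropy μ (fun ω => (X ω, Z ω)) = entropy μ X :=
    entropy_congr μ fun ω ω' => by rw [Prod.mk.injEq]; exact and_iff_left_of_imp (hX ω ω')
  have e₂ : entropy μ (fun ω => (Y ω, Z ω)) = entropy μ Y :=
    entropy_congr μ fun ω ω' => by rw [Prod.mk.injEq]; exact and_iff_left_of_imp (hY ω ω')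
  have e₃ : entropy μ (fun ω => (X ω, Y ω, Z ω)) = entropy μ U :=
    entropy_congr μ fun ω ω' => by
      rw [hU, Prod.mk.injEq, Prod.mk.injEq, and_iff_left_of_imp (hY ω ω')]
  rw [condMI, e₁, e₂, e₃] at h
  linarith

/-- The chain rule for the entropy of a variable `V` carrying the information of `(X, Z)`, under
the assumptions of `eventMass_prod_of_resample`. -/
theorem entropy_eq_add_of_resample {δ : Type*} {μ R : Ω → ℝ} {X : Ω → α} {Z : Ω → β}
    {V : Ω → γ} {s : β → δ} {K : δ → α → ℝ} (u : Ω → α → Ω)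
    (hV : ∀ ω ω', V ω = V ω' ↔ X ω = X ω' ∧ Z ω = Z ω') (hK : ∀ d, ∑ a, K d a = 1)
    (hXu : ∀ ω a, X (u ω a) = a) (huX : ∀ ω, u ω (X ω) = ω)
    (huu : ∀ ω a b, u (u ω a) b = u ω b) (hZu : ∀ ω a, Z (u ω a) = Z ω)
    (hRu : ∀ ω a, R (u ω a) = R ω) (hμ : ∀ ω, μ ω = R ω * K (s (Z ω)) (X ω)) :
    entropy μ V = entropy μ Z + ∑ ω, μ ω * ∑ a, Real.negMulLog (K (s (Z ω)) a) := by
  rw [entropy_congr μ (Y := fun ω => (X ω, Z ω)) fun ω ω' => by rw [hV, Prod.mk.injEq],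
    ← sum_eventMass_mul μ Z fun b => ∑ a, Real.negMulLog (K (s b) a)]
  change ∑ t, Real.negMulLog (eventMass μ (fun ω => (X ω, Z ω)) t) =
    ∑ b, Real.negMulLog (eventMass μ Z b) + _
  rw [Fintype.sum_prod_type_right, ← Finset.sum_add_distrib]
  refine Finset.sum_congr rfl fun b _ => ?_
  simp only [eventMass_prod_of_resample u hK hXu huX huu hZu hRu hμ, Real.negMulLog_mul,
    Finset.sum_add_distrib, ← Finset.sum_mul, ← Finset.mul_sum, hK, one_mul]

end Entropy

section SetFunctions

variable {ι : Type*} [DecidableEq ι]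

/-- For a submodular function, sets that are strict minimizers among their own subsets are
closed under union. -/
theorem lt_of_ssubset_union_of_submodular {g : Finset ι → ℝ}
    (hg : ∀ A B, g (A ∪ B) + g (A ∩ B) ≤ g A + g B) {D₁ D₂ : Finset ι}
    (h₁ : ∀ T ⊂ D₁, g D₁ < g T) (h₂ : ∀ T ⊂ D₂, g D₂ < g T) :
    ∀ T ⊂ D₁ ∪ D₂, g (D₁ ∪ D₂) < g T := by
  have hle : ∀ {D}, (∀ T ⊂ D, g D < g T) → ∀ A, g (A ∪ D) ≤ g A := fun {D} h A => by
    rcases (Finset.inter_subset_right : A ∩ D ⊆ D).eq_or_ssubset with h0 | h0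
    · linarith [hg A D, congrArg g h0]
    · linarith [hg A D, h _ h0]
  have hlt : ∀ {D}, (∀ T ⊂ D, g D < g T) → ∀ A, ¬ D ⊆ A → g (A ∪ D) < g A := fun {D} h A hA => by
    have h0 : A ∩ D ⊂ D :=
      Finset.inter_subset_right.ssubset_of_ne fun h => hA (Finset.inter_eq_right.1 h)
    linarith [hg A D, h _ h0]
  intro T hT
  have hU : T ∪ D₁ ∪ D₂ = D₁ ∪ D₂ := by
    rw [Finset.union_assoc, Finset.union_eq_right.2 hT.subset]
  rw [← hU]
  by_cases hD : D₁ ⊆ T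
  · rw [Finset.union_eq_left.2 hD]
    exact hlt h₂ T fun h => hT.not_subset (Finset.union_subset hD h)
  · exact (hle h₂ _).trans_lt (hlt h₁ T hD)

theorem apply_union_eq_add_sum {P : ι → Prop} {L : Finset ι → ℝ} {c : ι → ℝ}
    (hL : ∀ i A, P i → i ∉ A → L (insert i A) = L A + c i) (A S : Finset ι)
    (hS : ∀ i ∈ S, P i) (hd : Disjoint A S) : L (A ∪ S) = L A + ∑ i ∈ S, c i := by
  induction S using Finset.induction_on with
  | empty => simp
  | insert i S hi ih =>
    rw [Finset.disjoint_insert_right] at hd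
    rw [Finset.union_insert, hL i _ (hS i (by simp)) (by simp [hd.1, hi]),
      ih (fun j hj => hS j (by simp [hj])) hd.2, Finset.sum_insert hi]
    ring

end SetFunctions

section Relay

variable {n Mc : ℕ} {QA X0A YdA : Type} {XA YA YhA : Fin n → Type}

theorem rvXS_eq_iff {S : Finset (Fin n)} {ω ω' : DFOmega QA X0A XA YA YdA YhA} :
    rvXS S ω = rvXS S ω' ↔ ∀ i ∈ S, ω.2.2.1 i = ω'.2.2.1 i := by
  simp [funext_iff, rvXS]

theorem rvYS_eq_iff {S : Finset (Fin n)} {ω ω' : DFOmega QA X0A XA YA YdA YhA} :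
    rvYS S ω = rvYS S ω' ↔ ∀ i ∈ S, ω.2.2.2.1 i = ω'.2.2.2.1 i := by
  simp [funext_iff, rvYS]

theorem rvYhS_eq_iff {S : Finset (Fin n)} {ω ω' : DFOmega QA X0A XA YA YdA YhA} :
    rvYhS S ω = rvYhS S ω' ↔ ∀ i ∈ S, ω.2.2.2.2.2 i = ω'.2.2.2.2.2 i := by
  simp [funext_iff, rvYhS]

theorem muDF_nonneg {ℳ : Finset (Fin n)} {pQ : QA → ℝ} {p0 : QA → X0A → ℝ}
    {pM : QA → X0A → (∀ i : ℳ, XA i) → ℝ} {pC : ∀ i : Fin n, QA → XA i → ℝ}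
    {W : X0A → (∀ i, XA i) → ((∀ i, YA i) × YdA) → ℝ}
    {κ : ∀ i : Fin n, QA → YA i → XA i → YhA i → ℝ}
    (hpQ : ∀ q, 0 ≤ pQ q) (hp0 : ∀ q x, 0 ≤ p0 q x)
    (hpM : ∀ q x0 xm, 0 ≤ pM q x0 xm) (hpC : ∀ i q x, 0 ≤ pC i q x)
    (hW : ∀ x0 x y, 0 ≤ W x0 x y) (hκ : ∀ i q y x yh, 0 ≤ κ i q y x yh)
    (ω : DFOmega QA X0A XA YA YdA YhA) : 0 ≤ muDF ℳ pQ p0 pM pC W κ ω :=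
  mul_nonneg (mul_nonneg (mul_nonneg (mul_nonneg (mul_nonneg (hpQ _) (hp0 _ _)) (hpM _ _ _))
    (Finset.prod_nonneg fun _ _ => hpC _ _ _)) (hW _ _ _))
    (Finset.prod_nonneg fun _ _ => hκ _ _ _ _ _)

variable [Fintype QA] [DecidableEq QA] [Fintype X0A] [DecidableEq X0A]
  [Fintype YdA] [DecidableEq YdA]
  [∀ i, Fintype (XA i)] [∀ i, DecidableEq (XA i)]
  [∀ i, Fintype (YA i)] [∀ i, DecidableEq (YA i)]
  [∀ i, Fintype (YhA i)] [∀ i, DecidableEq (YhA i)]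

/-- `H(Ŷ_A, X_A, Y_{π(k)}, X_{π(1:M+1)}, Q)`. -/
noncomputable def observationEntropy (ℳ : Finset (Fin n)) (σ : Fin Mc → Fin n)
    (μ : DFOmega QA X0A XA YA YdA YhA → ℝ) (k : Fin (Mc + 1)) (A : Finset (Fin n)) : ℝ :=
  entropy μ fun ω => (rvYhS A ω, rvXS A ω, rvYk σ k ω, rvX0 ω, rvXS ℳ ω, rvQ ω)

/-- `H(X_A, X_{π(1:M+1)}, Q)`. -/
noncomputable def inputEntropy (ℳ : Finset (Fin n))
    (μ : DFOmega QA X0A XA YA YdA YhA → ℝ) (A : Finset (Fin n)) : ℝ :=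
  entropy μ fun ω => (rvXS A ω, rvX0 ω, rvXS ℳ ω, rvQ ω)

/-- `H(Ŷ_B, Y_S, X_D, Y_{π(k)}, X_{π(1:M+1)}, Q)`. -/
noncomputable def compressionEntropy (ℳ : Finset (Fin n)) (σ : Fin Mc → Fin n)
    (μ : DFOmega QA X0A XA YA YdA YhA → ℝ) (k : Fin (Mc + 1)) (S D B : Finset (Fin n)) : ℝ :=
  entropy μ fun ω => (rvYhS B ω, rvYS S ω, rvXS D ω, rvYk σ k ω, rvX0 ω, rvXS ℳ ω, rvQ ω)

theorem observationEntropy_submodular {μ : DFOmega QA X0A XA YA YdA YhA → ℝ}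
    (hμ : ∀ ω, 0 ≤ μ ω) (ℳ : Finset (Fin n)) (σ : Fin Mc → Fin n) (k : Fin (Mc + 1))
    (A B : Finset (Fin n)) :
    observationEntropy ℳ σ μ k (A ∪ B) + observationEntropy ℳ σ μ k (A ∩ B) ≤
      observationEntropy ℳ σ μ k A + observationEntropy ℳ σ μ k B := by
  refine entropy_add_entropy_le hμ (fun ω ω' => ?_) (fun ω ω' => ?_) fun ω ω' => ?_ <;>
  · simp only [Prod.mk.injEq, rvXS_eq_iff, rvYhS_eq_iff, Finset.mem_inter, Finset.mem_union]
    grind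

theorem selfDecodable_objective_eq (ℳ : Finset (Fin n)) (σ : Fin Mc → Fin n)
    (μ : DFOmega QA X0A XA YA YdA YhA → ℝ) (k : Fin (Mc + 1)) {S D : Finset (Fin n)}
    (hS : S ⊆ D) :
    condMI μ (rvXS S) (fun ω => (rvYhS (D \ S) ω, rvYk σ k ω))
        (fun ω => ((rvX0 ω, rvXS ℳ ω), rvXS (D \ S) ω, rvQ ω))
      - condMI μ (rvYS S) (rvYhS S)
        (fun ω => ((rvX0 ω, rvXS ℳ ω), rvXS D ω, rvYk σ k ω, rvYhS (D \ S) ω, rvQ ω)) =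
    (inputEntropy ℳ μ D - inputEntropy ℳ μ (D \ S)) +
      (compressionEntropy ℳ σ μ k S D D - compressionEntropy ℳ σ μ k S D (D \ S)) +
      (observationEntropy ℳ σ μ k (D \ S) - observationEntropy ℳ σ μ k D) := by
  have hD : ∀ {p : Fin n → Prop}, (∀ i ∈ D, p i) ↔ (∀ i ∈ S, p i) ∧ ∀ i ∈ D \ S, p i := by
    intro p
    simp only [Finset.mem_sdiff]
    grind
  have e₁ : entropy μ (fun ω => (rvXS S ω, (rvX0 ω, rvXS ℳ ω), rvXS (D \ S) ω, rvQ ω)) =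
      inputEntropy ℳ μ D := by
    refine entropy_congr μ fun ω ω' => ?_
    simp only [Prod.mk.injEq, rvXS_eq_iff, hD]
    tauto
  have e₂ : entropy μ (fun ω => ((rvYhS (D \ S) ω, rvYk σ k ω),
      (rvX0 ω, rvXS ℳ ω), rvXS (D \ S) ω, rvQ ω)) = observationEntropy ℳ σ μ k (D \ S) := by
    refine entropy_congr μ fun ω ω' => ?_
    simp only [Prod.mk.injEq]
    tauto
  have e₃ : entropy μ (fun ω => (rvXS S ω, (rvYhS (D \ S) ω, rvYk σ k ω),
      (rvX0 ω, rvXS ℳ ω), rvXS (D \ S) ω, rvQ ω)) = entropy μ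
      (fun ω => ((rvX0 ω, rvXS ℳ ω), rvXS D ω, rvYk σ k ω, rvYhS (D \ S) ω, rvQ ω)) := by
    refine entropy_congr μ fun ω ω' => ?_
    simp only [Prod.mk.injEq, rvXS_eq_iff, hD]
    tauto
  have e₄ : entropy μ (fun ω => ((rvX0 ω, rvXS ℳ ω), rvXS (D \ S) ω, rvQ ω)) =
      inputEntropy ℳ μ (D \ S) := by
    refine entropy_congr μ fun ω ω' => ?_
    simp only [Prod.mk.injEq]
    tauto
  have e₅ : entropy μ (fun ω => (rvYS S ω,
      (rvX0 ω, rvXS ℳ ω), rvXS D ω, rvYk σ k ω, rvYhS (D \ S) ω, rvQ ω)) =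
      compressionEntropy ℳ σ μ k S D (D \ S) := by
    refine entropy_congr μ fun ω ω' => ?_
    simp only [Prod.mk.injEq]
    tauto
  have e₆ : entropy μ (fun ω => (rvYhS S ω,
      (rvX0 ω, rvXS ℳ ω), rvXS D ω, rvYk σ k ω, rvYhS (D \ S) ω, rvQ ω)) =
      observationEntropy ℳ σ μ k D := by
    refine entropy_congr μ fun ω ω' => ?_
    simp only [Prod.mk.injEq, rvYhS_eq_iff, hD]
    tauto
  have e₇ : entropy μ (fun ω => (rvYS S ω, rvYhS S ω,
      (rvX0 ω, rvXS ℳ ω), rvXS D ω, rvYk σ k ω, rvYhS (D \ S) ω, rvQ ω)) =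
      compressionEntropy ℳ σ μ k S D D := by
    refine entropy_congr μ fun ω ω' => ?_
    simp only [Prod.mk.injEq, rvYhS_eq_iff, hD]
    tauto
  simp only [condMI, e₁, e₂, e₃, e₄, e₅, e₆, e₇]
  ring

/-- The marginal of `muDF` on `(q, x₀, (xᵢ)ᵢ)`. -/
noncomputable def inputLaw (ℳ : Finset (Fin n)) (pQ : QA → ℝ) (p0 : QA → X0A → ℝ)
    (pM : QA → X0A → (∀ i : ℳ, XA i) → ℝ) (pC : ∀ i : Fin n, QA → XA i → ℝ) :
    QA × X0A × (∀ i, XA i) → ℝ :=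
  fun t => pQ t.1 * p0 t.1 t.2.1 * pM t.1 t.2.1 (fun i => t.2.2 i) * ∏ i ∈ ℳᶜ, pC i t.1 (t.2.2 i)

variable {ℳ : Finset (Fin n)} {pQ : QA → ℝ} {p0 : QA → X0A → ℝ}
  {pM : QA → X0A → (∀ i : ℳ, XA i) → ℝ} {pC : ∀ i : Fin n, QA → XA i → ℝ}
  {W : X0A → (∀ i, XA i) → ((∀ i, YA i) × YdA) → ℝ}
  {κ : ∀ i : Fin n, QA → YA i → XA i → YhA i → ℝ}

theorem eventMass_muDF_input (hWs : ∀ x0 x, ∑ y, W x0 x y = 1)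
    (hκs : ∀ i q y x, ∑ yh, κ i q y x yh = 1) (t : QA × X0A × (∀ i, XA i)) :
    eventMass (muDF ℳ pQ p0 pM pC W κ) (fun ω => (ω.1, ω.2.1, ω.2.2.1)) t =
      inputLaw ℳ pQ p0 pM pC t := by
  obtain ⟨q, x0, x⟩ := t
  have hκprod : ∀ y : ∀ i, YA i, ∑ yh : ∀ i, YhA i, ∏ i, κ i q (y i) (x i) (yh i) = 1 := by
    intro y
    rw [← Fintype.prod_sum]
    simp [hκs]
  have hWs' := hWs x0 x
  rw [Fintype.sum_prod_type] at hWs'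
  have hchannel : ∑ y : ∀ i, YA i, ∑ yd : YdA, ∑ yh : ∀ i, YhA i,
      inputLaw ℳ pQ p0 pM pC (q, x0, x) * W x0 x (y, yd) *
      ∏ i, κ i q (y i) (x i) (yh i) = inputLaw ℳ pQ p0 pM pC (q, x0, x) := by
    simp only [← Finset.mul_sum, hκprod, mul_one, hWs']
  rw [← hchannel, eventMass, Finset.sum_filter]
  simp only [Fintype.sum_prod_type, Prod.mk.injEq, ite_and]
  rw [Finset.sum_eq_single q (by simp +contextual) (by simp),
    Finset.sum_eq_single x0 (by simp +contextual) (by simp),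
    Finset.sum_eq_single x (by simp +contextual) (by simp)]
  simp [muDF, inputLaw]

theorem inputEntropy_insert (hpCs : ∀ i q, ∑ x, pC i q x = 1)
    (hWs : ∀ x0 x, ∑ y, W x0 x y = 1) (hκs : ∀ i q y x, ∑ yh, κ i q y x yh = 1)
    {i : Fin n} (hi : i ∈ ℳᶜ) {A : Finset (Fin n)} (hiA : i ∉ A) :
    inputEntropy ℳ (muDF ℳ pQ p0 pM pC W κ) (insert i A) =
      inputEntropy ℳ (muDF ℳ pQ p0 pM pC W κ) A +
        ∑ t, inputLaw ℳ pQ p0 pM pC t * ∑ x, Real.negMulLog (pC i t.1 x) := by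
  have hiℳ : ∀ j : ℳ, (j : Fin n) ≠ i := fun j h => Finset.mem_compl.1 hi (h ▸ j.2)
  have hiA' : ∀ j : A, (j : Fin n) ≠ i := fun j h => hiA (h ▸ j.2)
  let Z : QA × X0A × (∀ i, XA i) → (∀ j : A, XA j) × X0A × (∀ j : ℳ, XA j) × QA :=
    fun t => (fun j => t.2.2 j, t.2.1, fun j => t.2.2 j, t.1)
  have hlaw := eventMass_muDF_input (ℳ := ℳ) (pQ := pQ) (p0 := p0) (pM := pM) (pC := pC) hWs hκs
  have hins : inputEntropy ℳ (muDF ℳ pQ p0 pM pC W κ) (insert i A) =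
      entropy (inputLaw ℳ pQ p0 pM pC) fun t => ((fun j => t.2.2 j : ∀ j : ↥(insert i A), XA j),
        t.2.1, (fun j => t.2.2 j : ∀ j : ℳ, XA j), t.1) :=
    entropy_comp_of_eventMass hlaw fun t : QA × X0A × (∀ i, XA i) =>
      ((fun j => t.2.2 j : ∀ j : ↥(insert i A), XA j), t.2.1,
        (fun j => t.2.2 j : ∀ j : ℳ, XA j), t.1)
  have hbase : inputEntropy ℳ (muDF ℳ pQ p0 pM pC W κ) A =
      entropy (inputLaw ℳ pQ p0 pM pC) Z :=
    entropy_comp_of_eventMass hlaw Z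
  rw [hins, hbase]
  refine entropy_eq_add_of_resample (X := fun t => t.2.2 i) (Z := Z)
    (s := fun z => z.2.2.2) (K := pC i)
    (R := fun t => pQ t.1 * p0 t.1 t.2.1 * pM t.1 t.2.1 (fun i => t.2.2 i) *
      ∏ j ∈ ℳᶜ.erase i, pC j t.1 (t.2.2 j))
    (fun t x => (t.1, t.2.1, Function.update t.2.2 i x)) ?_ (hpCs i) ?_ ?_ ?_ ?_ ?_ ?_
  · intro t t'
    simp only [Z, Prod.mk.injEq, funext_iff, Subtype.forall]
    grind
  · simp
  · simp
  · simp
  · intro t x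
    simp [Z, Function.update_of_ne, hiℳ, hiA']
  · intro t x
    have hprod : ∏ j ∈ ℳᶜ.erase i, pC j t.1 (Function.update t.2.2 i x j) =
        ∏ j ∈ ℳᶜ.erase i, pC j t.1 (t.2.2 j) := Finset.prod_congr rfl fun j hj => by
      rw [Function.update_of_ne (Finset.ne_of_mem_erase hj)]
    simp [Function.update_of_ne, hiℳ, hprod]
  · intro t
    simp only [inputLaw, Z]
    rw [← Finset.prod_erase_mul _ _ hi]
    ring

theorem compressionEntropy_insert (hκs : ∀ i q y x, ∑ yh, κ i q y x yh = 1)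
    (σ : Fin Mc → Fin n) (k : Fin (Mc + 1)) {S D B : Finset (Fin n)} {i : Fin n} (hiS : i ∈ S)
    (hiD : i ∈ D) (hiB : i ∉ B) :
    compressionEntropy ℳ σ (muDF ℳ pQ p0 pM pC W κ) k S D (insert i B) =
      compressionEntropy ℳ σ (muDF ℳ pQ p0 pM pC W κ) k S D B +
        ∑ ω, muDF ℳ pQ p0 pM pC W κ ω *
          ∑ yh, Real.negMulLog (κ i ω.1 (ω.2.2.2.1 i) (ω.2.2.1 i) yh) := by
  have hiB' : ∀ j : B, (j : Fin n) ≠ i := fun j h => hiB (h ▸ j.2)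
  let Z := fun ω : DFOmega QA X0A XA YA YdA YhA =>
    (rvYhS B ω, rvYS S ω, rvXS D ω, rvYk σ k ω, rvX0 ω, rvXS ℳ ω, rvQ ω)
  refine entropy_eq_add_of_resample (X := fun ω => ω.2.2.2.2.2 i) (Z := Z)
    (s := fun z => (z.2.2.2.2.2.2, z.2.1 ⟨i, hiS⟩, z.2.2.1 ⟨i, hiD⟩))
    (K := fun d => κ i d.1 d.2.1 d.2.2)
    (R := fun ω => pQ ω.1 * p0 ω.1 ω.2.1 * pM ω.1 ω.2.1 (fun i => ω.2.2.1 i)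
      * (∏ i ∈ ℳᶜ, pC i ω.1 (ω.2.2.1 i)) * W ω.2.1 ω.2.2.1 (ω.2.2.2.1, ω.2.2.2.2.1)
      * ∏ j ∈ Finset.univ.erase i, κ j ω.1 (ω.2.2.2.1 j) (ω.2.2.1 j) (ω.2.2.2.2.2 j))
    (fun ω yh => (ω.1, ω.2.1, ω.2.2.1, ω.2.2.2.1, ω.2.2.2.2.1,
      Function.update ω.2.2.2.2.2 i yh)) ?_ (fun d => hκs i _ _ _) ?_ ?_ ?_ ?_ ?_ ?_
  · intro ω ω'
    simp only [Z, Prod.mk.injEq, rvYhS_eq_iff, Finset.forall_mem_insert]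
    tauto
  · simp
  · simp
  · simp
  · intro ω yh
    refine Prod.ext (funext fun j => ?_) rfl
    exact Function.update_of_ne (hiB' j) _ _
  · intro ω yh
    refine congrArg _ (Finset.prod_congr rfl fun j hj => ?_)
    simp only [Function.update_of_ne (Finset.ne_of_mem_erase hj)]
  · intro ω
    simp only [muDF, Z]
    rw [← Finset.prod_erase_mul _ _ (Finset.mem_univ i), ← mul_assoc]
    rfl

/-- Self-decodability of `D` says that `D` is the strict minimizer, among its subsets, of
`H(Ŷ_A, X_A, Y_{π(k)}, X_{π(1:M+1)}, Q)` corrected by a modular function of `A`. -/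
theorem exists_selfDecodable_iff (hpCs : ∀ i q, ∑ x, pC i q x = 1)
    (hWs : ∀ x0 x, ∑ y, W x0 x y = 1) (hκs : ∀ i q y x, ∑ yh, κ i q y x yh = 1)
    (σ : Fin Mc → Fin n) (k : Fin (Mc + 1)) :
    ∃ c : Fin n → ℝ, ∀ D ⊆ ℳᶜ, SelfDecodable ℳ σ (muDF ℳ pQ p0 pM pC W κ) k D ↔
      ∀ T ⊂ D, observationEntropy ℳ σ (muDF ℳ pQ p0 pM pC W κ) k D - ∑ i ∈ D, c i <
        observationEntropy ℳ σ (muDF ℳ pQ p0 pM pC W κ) k T - ∑ i ∈ T, c i := by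
  set μ := muDF ℳ pQ p0 pM pC W κ
  let a : Fin n → ℝ := fun i =>
    ∑ t, inputLaw ℳ pQ p0 pM pC t * ∑ x, Real.negMulLog (pC i t.1 x)
  let b : Fin n → ℝ := fun i =>
    ∑ ω, μ ω * ∑ yh, Real.negMulLog (κ i ω.1 (ω.2.2.2.1 i) (ω.2.2.1 i) yh)
  refine ⟨fun i => a i + b i, fun D hD => ?_⟩
  have hobj : ∀ S ⊆ D, condMI μ (rvXS S) (fun ω => (rvYhS (D \ S) ω, rvYk σ k ω))
        (fun ω => ((rvX0 ω, rvXS ℳ ω), rvXS (D \ S) ω, rvQ ω))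
      - condMI μ (rvYS S) (rvYhS S)
        (fun ω => ((rvX0 ω, rvXS ℳ ω), rvXS D ω, rvYk σ k ω, rvYhS (D \ S) ω, rvQ ω)) =
      (observationEntropy ℳ σ μ k (D \ S) - ∑ i ∈ D \ S, (a i + b i)) -
        (observationEntropy ℳ σ μ k D - ∑ i ∈ D, (a i + b i)) := fun S hS => by
    have hin := apply_union_eq_add_sum (P := (· ∈ ℳᶜ)) (L := inputEntropy ℳ μ) (c := a)
      (fun i A hi hiA => inputEntropy_insert hpCs hWs hκs hi hiA) (D \ S) S
      (fun i hi => hD (hS hi)) Finset.sdiff_disjoint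
    have hcomp := apply_union_eq_add_sum (P := (· ∈ S)) (L := compressionEntropy ℳ σ μ k S D)
      (c := b) (fun i A hi hiA => compressionEntropy_insert hκs σ k hi (hS hi) hiA) (D \ S) S
      (fun i hi => hi) Finset.sdiff_disjoint
    rw [Finset.sdiff_union_of_subset hS] at hin hcomp
    rw [selfDecodable_objective_eq ℳ σ μ k hS, hin, hcomp,
      ← Finset.sum_sdiff hS (f := fun i => a i + b i), Finset.sum_add_distrib (s := S)]
    ring
  constructor
  · intro h T hT
    have hpos := h (D \ T) Finset.sdiff_subset (Finset.sdiff_nonempty.2 hT.not_subset)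
    rwa [hobj _ Finset.sdiff_subset, Finset.sdiff_sdiff_eq_self hT.subset, sub_pos] at hpos
  · intro h S hS hne
    rw [hobj S hS, sub_pos]
    exact h _ (Finset.sdiff_ssubset hS hne)

end Relay

/-- For each `k ∈ {2,…,M+2}` (encoded as `k : Fin (Mc+1)`), if
`D₁ ⊆ N∖M` and `D₂ ⊆ N∖M` are both self-decodable at node `π(k)`, then `D₁ ∪ D₂`
is also self-decodable at node `π(k)`. -/
theorem selfDecodable_union
    {n Mc : ℕ} {QA X0A YdA : Type} {XA YA YhA : Fin n → Type}
    [Fintype QA] [DecidableEq QA] [Fintype X0A] [DecidableEq X0A]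
    [Fintype YdA] [DecidableEq YdA]
    [∀ i, Fintype (XA i)] [∀ i, DecidableEq (XA i)]
    [∀ i, Fintype (YA i)] [∀ i, DecidableEq (YA i)]
    [∀ i, Fintype (YhA i)] [∀ i, DecidableEq (YhA i)]
    (ℳ : Finset (Fin n)) (hMcard : ℳ.card = Mc)
    (σ : Fin Mc → Fin n) (hσinj : Function.Injective σ)
    (hσmem : ∀ j, σ j ∈ ℳ) (hσsurj : ∀ i ∈ ℳ, ∃ j, σ j = i)
    (pQ : QA → ℝ) (p0 : QA → X0A → ℝ)
    (pM : QA → X0A → (∀ i : ℳ, XA i) → ℝ) (pC : ∀ i : Fin n, QA → XA i → ℝ)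
    (W : X0A → (∀ i, XA i) → ((∀ i, YA i) × YdA) → ℝ)
    (κ : ∀ i : Fin n, QA → YA i → XA i → YhA i → ℝ)
    (hpQ : ∀ q, 0 ≤ pQ q) (hpQs : ∑ q, pQ q = 1)
    (hp0 : ∀ q x, 0 ≤ p0 q x) (hp0s : ∀ q, ∑ x, p0 q x = 1)
    (hpM : ∀ q x0 xm, 0 ≤ pM q x0 xm) (hpMs : ∀ q x0, ∑ xm, pM q x0 xm = 1)
    (hpC : ∀ i q x, 0 ≤ pC i q x) (hpCs : ∀ i q, ∑ x, pC i q x = 1)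
    (hW : ∀ x0 x y, 0 ≤ W x0 x y) (hWs : ∀ x0 x, ∑ y, W x0 x y = 1)
    (hκ : ∀ i q y x yh, 0 ≤ κ i q y x yh) (hκs : ∀ i q y x, ∑ yh, κ i q y x yh = 1)
    (k : Fin (Mc + 1)) (D₁ D₂ : Finset (Fin n))
    (hD₁sub : D₁ ⊆ ℳᶜ) (hD₂sub : D₂ ⊆ ℳᶜ)
    (hD₁ : SelfDecodable ℳ σ (muDF ℳ pQ p0 pM pC W κ) k D₁)
    (hD₂ : SelfDecodable ℳ σ (muDF ℳ pQ p0 pM pC W κ) k D₂) :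
    SelfDecodable ℳ σ (muDF ℳ pQ p0 pM pC W κ) k (D₁ ∪ D₂) := by
  obtain ⟨c, hc⟩ := exists_selfDecodable_iff (ℳ := ℳ) (pQ := pQ) (p0 := p0) (pM := pM)
    hpCs hWs hκs σ k
  rw [hc _ hD₁sub] at hD₁
  rw [hc _ hD₂sub] at hD₂
  rw [hc _ (Finset.union_subset hD₁sub hD₂sub)]
  refine lt_of_ssubset_union_of_submodular
    (g := fun A => observationEntropy ℳ σ (muDF ℳ pQ p0 pM pC W κ) k A - ∑ i ∈ A, c i)
    (fun A B => ?_) hD₁ hD₂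
  have hsub := observationEntropy_submodular (muDF_nonneg hpQ hp0 hpM hpC hW hκ) ℳ σ k A B
  have hsum := Finset.sum_union_inter (s₁ := A) (s₂ := B) (f := c)
  linarith
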